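/- arXiv:2310.12984 — 12 statements merged into one kernel-verified Lean document; each statement's English description precedes it below -/
import Mathlib

section
/- Let n_e be a pure high extremal point of J (i.e., J(n_e) = n_e − 1) with n_e even, and let m be the next high extremal point after n_e (i.e., m is a high extremal point, m > n_e, and there is no high extremal point strictly between n_e and m). Then m = (3·n_e + 2)/2 and m is a fixed point of J, i.e., J(m) = m. -/
/-- The Josephus function with reduction constant 3:
`J 1 = 1` and `J n = ((J (n-1) + 2) % n) + 1` for `n ≥ 2`. -/
def J : ℕ → ℕ
  | 0 => 0
  | 1 => 1
  | n + 2 => (J (n + 1) + 2) % (n + 2) + 1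

/-- `n ≥ 1` is a high extremal point if `J n ∈ {n-1, n}`. -/
def IsHighExtremal (n : ℕ) : Prop := 1 ≤ n ∧ (J n = n - 1 ∨ J n = n)

/-- After a pure high extremal point `2 * p`, the values of `J` restart at `1` and increase
by `3` at each step, up to the fixed point `3 * p + 1`. -/
theorem J_add_of_pure {p : ℕ} (hp : 1 ≤ p) (h : J (2 * p) = 2 * p - 1) :
    ∀ i ≤ p, J (2 * p + 1 + i) = 3 * i + 1 := by
  intro i
  induction i with
  | zero =>
    intro _
    obtain ⟨q, rfl⟩ : ∃ q, p = q + 1 := ⟨p - 1, by omega⟩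
    change (J (2 * (q + 1)) + 2) % (2 * (q + 1) + 1) + 1 = 1
    rw [h, show 2 * (q + 1) - 1 + 2 = 2 * (q + 1) + 1 by omega, Nat.mod_self]
  | succ i ih =>
    intro hi
    have key : J (2 * p + 1 + (i + 1)) = (J (2 * p + 1 + i) + 2) % (2 * p + 1 + (i + 1)) + 1 := by
      rw [show 2 * p + 1 + (i + 1) = (2 * p + i) + 2 by omega,
        show 2 * p + 1 + i = (2 * p + i) + 1 by omega, J]
    rw [key, ih (by omega), Nat.mod_eq_of_lt (by omega)]
    omega

theorem stmt_0 (n_e m : ℕ) (h1 : 1 ≤ n_e) (hpure : J n_e = n_e - 1) (heven : Even n_e)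
    (hm : IsHighExtremal m) (hlt : n_e < m)
    (hnext : ∀ k, n_e < k → k < m → ¬ IsHighExtremal k) :
    m = (3 * n_e + 2) / 2 ∧ J m = m := by
  obtain ⟨p, rfl⟩ := heven
  rw [← two_mul] at *
  have hJ := J_add_of_pure (by omega) hpure
  have hfix : J (3 * p + 1) = 3 * p + 1 := by
    have h := hJ p le_rfl
    rwa [show 2 * p + 1 + p = 3 * p + 1 by omega] at h
  have hle : m ≤ 3 * p + 1 := by
    by_contra! hgt
    exact hnext (3 * p + 1) (by omega) hgt ⟨by omega, Or.inr hfix⟩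
  obtain ⟨i, rfl⟩ : ∃ i, m = 2 * p + 1 + i := ⟨m - (2 * p + 1), by omega⟩
  have hi := hJ i (by omega)
  obtain ⟨-, hm⟩ := hm
  omega
end

section
/- Let n_e be a pure high extremal point of J (i.e., J(n_e) = n_e − 1) with n_e odd, and let m be the next high extremal point after n_e (i.e., m is a high extremal point, m > n_e, and there is no high extremal point strictly between n_e and m). Then m = (3·n_e + 1)/2 and m is a pure high extremal point, i.e., J(m) = m − 1. -/
/-- After an odd pure high extremal point `2 * t + 1`, the values of `J` restart at `1` and
grow by `3` at each step, up to the point `3 * t + 2`. -/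
theorem J_add_of_pure_odd {t : ℕ} (h : J (2 * t + 1) = 2 * t) (j : ℕ) (hj : j ≤ t) :
    J (2 * t + 2 + j) = 3 * j + 1 := by
  induction j with
  | zero =>
    change (J (2 * t + 1) + 2) % (2 * t + 2) + 1 = 1
    rw [h, Nat.mod_self]
  | succ j ih =>
    have step : J (2 * t + 2 + (j + 1)) =
        (J (2 * t + 1 + j + 1) + 2) % (2 * t + 1 + j + 2) + 1 := by
      rw [show 2 * t + 2 + (j + 1) = 2 * t + 1 + j + 2 by omega, J]
    rw [step, show 2 * t + 1 + j + 1 = 2 * t + 2 + j by omega, ih (by omega),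
      Nat.mod_eq_of_lt (by omega)]
    omega

theorem stmt_1 (n_e m : ℕ) (h1 : 1 ≤ n_e) (hpure : J n_e = n_e - 1) (hodd : Odd n_e)
    (hm : IsHighExtremal m) (hlt : n_e < m)
    (hnext : ∀ k, n_e < k → k < m → ¬ IsHighExtremal k) :
    m = (3 * n_e + 1) / 2 ∧ J m = m - 1 := by
  obtain ⟨t, rfl⟩ := hodd
  have hJ := J_add_of_pure_odd (t := t) (by simpa using hpure)
  have hend := hJ t le_rfl
  have hle : m ≤ 2 * t + 2 + t := by
    by_contra! hgt
    exact hnext _ (by omega) hgt ⟨by omega, Or.inl (by omega)⟩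
  obtain ⟨j, rfl⟩ := Nat.exists_eq_add_of_le (show 2 * t + 2 ≤ m by omega)
  have hval := hJ j (by omega)
  obtain ⟨-, hm | hm⟩ := hm <;> omega
end

section
/- Let n_e be a fixed point of J (i.e., J(n_e) = n_e) with n_e even, and let m be the next high extremal point after n_e (i.e., m is a high extremal point, m > n_e, and there is no high extremal point strictly between n_e and m). Then m = 3·n_e/2 and m is a pure high extremal point, i.e., J(m) = m − 1. -/
theorem J_succ {n : ℕ} (hn : 1 ≤ n) : J (n + 1) = (J n + 2) % (n + 1) + 1 := by
  obtain ⟨k, rfl⟩ := Nat.exists_eq_add_of_le' hn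
  rfl

/-- After an even fixed point `2 * p`, the values of `J` climb in steps of 3 starting from 2. -/
theorem J_two_mul_add_of_fixed {p : ℕ} (hp : 1 ≤ p) (hfix : J (2 * p) = 2 * p) :
    ∀ j < p, J (2 * p + 1 + j) = 2 + 3 * j := by
  intro j
  induction j with
  | zero =>
    intro _
    rw [Nat.add_zero, J_succ (by omega), hfix,
      show 2 * p + 2 = 1 + (2 * p + 1) by omega, Nat.add_mod_right, Nat.mod_eq_of_lt (by omega)]
  | succ j ih =>
    intro hj
    rw [← Nat.add_assoc, J_succ (by omega), ih (by omega), Nat.mod_eq_of_lt (by omega)]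
    omega

theorem stmt_2 (n_e m : ℕ) (h1 : 1 ≤ n_e) (hfix : J n_e = n_e) (heven : Even n_e)
    (hm : IsHighExtremal m) (hlt : n_e < m)
    (hnext : ∀ k, n_e < k → k < m → ¬ IsHighExtremal k) :
    m = 3 * n_e / 2 ∧ J m = m - 1 := by
  obtain ⟨p, hp⟩ := heven
  obtain rfl : n_e = 2 * p := by omega
  have climb := J_two_mul_add_of_fixed (by omega) hfix
  have hge : 3 * p ≤ m := by
    by_contra! h
    have hJ := climb (m - (2 * p + 1)) (by omega)
    rw [Nat.add_sub_cancel' (by omega)] at hJ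
    obtain ⟨-, h | h⟩ := hm <;> omega
  have hJ := climb (p - 1) (by omega)
  rw [show 2 * p + 1 + (p - 1) = 3 * p by omega] at hJ
  have hle : m ≤ 3 * p := by
    by_contra! h
    exact hnext (3 * p) (by omega) h ⟨by omega, Or.inl (by omega)⟩
  obtain rfl : m = 3 * p := by omega
  omega
end

section
/- Let n_e be a fixed point of J (i.e., J(n_e) = n_e) with n_e odd, and let m be the next high extremal point after n_e (i.e., m is a high extremal point, m > n_e, and there is no high extremal point strictly between n_e and m). Then m = (3·n_e + 1)/2 and m is a fixed point of J, i.e., J(m) = m. -/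
theorem J_add_of_fixed {n : ℕ} (h1 : 1 ≤ n) (hfix : J n = n) (k : ℕ) (hk : 2 * k + 1 ≤ n) :
    J (n + 1 + k) = 2 + 3 * k := by
  induction k with
  | zero =>
    obtain ⟨p, rfl⟩ : ∃ p, n = p + 1 := ⟨n - 1, by omega⟩
    change (J (p + 1) + 2) % (p + 2) + 1 = 2
    rw [hfix, show p + 1 + 2 = 1 + (p + 2) by ring, Nat.add_mod_right,
      Nat.mod_eq_of_lt (by omega)]
  | succ k ih =>
    obtain ⟨p, hp⟩ : ∃ p, n + 1 + k = p + 1 := ⟨n + k, by omega⟩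
    have ih := ih (by omega)
    rw [show n + 1 + (k + 1) = p + 2 by omega]
    change (J (p + 1) + 2) % (p + 2) + 1 = _
    rw [← hp, ih, Nat.mod_eq_of_lt (by omega)]
    ring

theorem stmt_3 (n_e m : ℕ) (h1 : 1 ≤ n_e) (hfix : J n_e = n_e) (hodd : Odd n_e)
    (hm : IsHighExtremal m) (hlt : n_e < m)
    (hnext : ∀ k, n_e < k → k < m → ¬ IsHighExtremal k) :
    m = (3 * n_e + 1) / 2 ∧ J m = m := by
  obtain ⟨t, ht⟩ := hodd
  have hJt := J_add_of_fixed h1 hfix t (by omega)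
  have hle : m ≤ n_e + 1 + t := by
    by_contra! h
    exact hnext _ (by omega) h ⟨by omega, Or.inr (by omega)⟩
  obtain ⟨k, rfl⟩ : ∃ k, m = n_e + 1 + k := ⟨m - (n_e + 1), by omega⟩
  have hJk := J_add_of_fixed h1 hfix k (by omega)
  obtain ⟨-, h | h⟩ := hm <;> constructor <;> omega
end

section
/- Let n_e be a fixed point of J (i.e., J(n_e) = n_e), and let m be the next high extremal point after n_e (i.e., m is a high extremal point, m > n_e, and there is no high extremal point strictly between n_e and m). Then m is a fixed point of J if and only if n_e is odd. -/
theorem J_add_two (n : ℕ) : J (n + 2) = (J (n + 1) + 2) % (n + 2) + 1 := rfl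

/-- After a fixed point, `J` restarts at `2` and grows by `3` until it would exceed its argument. -/
theorem J_add_one_add_of_fixed {n : ℕ} (hn : 1 ≤ n) (hfix : J n = n) (k : ℕ)
    (hk : 2 * k + 1 ≤ n) : J (n + 1 + k) = 3 * k + 2 := by
  induction k with
  | zero =>
    obtain ⟨p, rfl⟩ : ∃ p, n = p + 1 := ⟨n - 1, by omega⟩
    have hmod : (p + 1 + 2) % (p + 2) = 1 := by
      rw [show p + 1 + 2 = 1 + (p + 2) by omega, Nat.add_mod_right]
      exact Nat.mod_eq_of_lt (by omega)
    change J (p + 2) = _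
    rw [J_add_two, hfix, hmod]
  | succ k ih =>
    have hrec := J_add_two (n + k)
    rw [show n + k + 1 = n + 1 + k by omega, ih (by omega),
      Nat.mod_eq_of_lt (by omega)] at hrec
    rw [show n + 1 + (k + 1) = n + k + 2 by omega, hrec]
    omega

theorem stmt_4 (n_e m : ℕ) (h1 : 1 ≤ n_e) (hfix : J n_e = n_e)
    (hm : IsHighExtremal m) (hlt : n_e < m)
    (hnext : ∀ k, n_e < k → k < m → ¬ IsHighExtremal k) :
    J m = m ↔ Odd n_e := by
  have hle : m ≤ n_e + 1 + (n_e - 1) / 2 := by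
    by_contra! h
    refine hnext _ (by omega) h ⟨by omega, ?_⟩
    rw [J_add_one_add_of_fixed h1 hfix _ (by omega)]
    omega
  obtain ⟨k, rfl⟩ : ∃ k, m = n_e + 1 + k := ⟨m - (n_e + 1), by omega⟩
  obtain ⟨-, hm⟩ := hm
  rw [J_add_one_add_of_fixed h1 hfix k (by omega)] at hm ⊢
  rw [Nat.odd_iff]
  omega
end

section
/- Let n_e be a pure high extremal point of J (i.e., J(n_e) = n_e − 1), and let m be the next high extremal point after n_e (i.e., m is a high extremal point, m > n_e, and there is no high extremal point strictly between n_e and m). Then m is a fixed point of J if and only if n_e is even. -/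
/-- After a pure high extremal point `n`, the function restarts at `1` and grows in steps of `3`
until the next high extremal point. -/
theorem J_add_of_eq_pred {n : ℕ} (hn : 1 ≤ n) (h : J n = n - 1) (k : ℕ) (hk : 2 * k ≤ n) :
    J (n + 1 + k) = 1 + 3 * k := by
  induction k with
  | zero =>
    have hmod : J n + 2 = n + 1 := by omega
    rw [Nat.add_zero, J_succ hn, hmod, Nat.mod_self]
  | succ k ih =>
    rw [← Nat.add_assoc, J_succ (by omega), ih (by omega), Nat.mod_eq_of_lt (by omega)]
    omega

theorem stmt_5 (n_e m : ℕ) (h1 : 1 ≤ n_e) (hpure : J n_e = n_e - 1)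
    (hm : IsHighExtremal m) (hlt : n_e < m)
    (hnext : ∀ k, n_e < k → k < m → ¬ IsHighExtremal k) :
    J m = m ↔ Even n_e := by
  have hle : m ≤ n_e + 1 + n_e / 2 := by
    by_contra! hgt
    refine hnext _ (by omega) hgt ⟨by omega, ?_⟩
    rw [J_add_of_eq_pred h1 hpure _ (by omega)]
    omega
  obtain ⟨k, rfl⟩ := Nat.exists_eq_add_of_le hlt
  have hJ : J (n_e + 1 + k) = 1 + 3 * k := J_add_of_eq_pred h1 hpure k (by omega)
  have hext := hm.2
  rw [Nat.succ_eq_add_one, hJ] at hext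
  rw [Nat.succ_eq_add_one, hJ, Nat.even_iff]
  omega
end

section
/- Let n be a high extremal point of J, let m be the next high extremal point after n (i.e., m is a high extremal point, m > n, and there is no high extremal point strictly between n and m), and set f := n − J(n) and r := n mod 2. Then, as integers, m − J(m) = f − (1 − r)·(2·f − 1). -/
/-- After a high extremal point `n` with `n - J n = f`, the values of `J` start again at `2 - f`
and grow in steps of `3` until the next high extremal point. -/
theorem J_add_eq_of_highExtremal {n f : ℕ} (hn : 1 ≤ n) (hf : f ≤ 1) (h : J n + f = n) (j : ℕ)
    (hj : 2 * j + 1 ≤ n + f) : J (n + 1 + j) + f = 2 + 3 * j := by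
  induction j with
  | zero =>
    have hsplit : J n + 2 = (1 - f) + (n + 1) := by omega
    rw [Nat.add_zero, J_succ hn, hsplit, Nat.add_mod_right, Nat.mod_eq_of_lt (by omega)]
    omega
  | succ j ih =>
    have ih := ih (by omega)
    rw [← Nat.add_assoc, J_succ (by omega), Nat.mod_eq_of_lt (by omega)]
    omega

theorem stmt_8 (n m : ℕ) (hn : IsHighExtremal n)
    (hm : IsHighExtremal m) (hlt : n < m)
    (hnext : ∀ k, n < k → k < m → ¬ IsHighExtremal k)
    (f r : ℤ) (hf : f = (n : ℤ) - (J n : ℤ)) (hr : r = (n : ℤ) % 2) :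
    (m : ℤ) - (J m : ℤ) = f - (1 - r) * (2 * f - 1) := by
  obtain ⟨hn1, hJn⟩ := hn
  obtain ⟨hm1, hJm⟩ := hm
  obtain ⟨g, hg, hgn⟩ : ∃ g ≤ 1, J n + g = n := ⟨n - J n, by omega, by omega⟩
  have hval := J_add_eq_of_highExtremal hn1 hg hgn
  have hle : m ≤ n + 1 + (n + g - 1) / 2 := by
    by_contra! hlt'
    have hv := hval ((n + g - 1) / 2) (by omega)
    exact hnext _ (by omega) hlt' ⟨by omega, by omega⟩
  obtain ⟨j, rfl⟩ := Nat.exists_eq_add_of_le (Nat.succ_le_of_lt hlt)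
  have hv := hval j (by omega)
  simp only [Nat.succ_eq_add_one] at *
  have hfg : f = g := by omega
  subst hfg hr
  rcases Nat.mod_two_eq_zero_or_one n with h | h
  · have hr : (n : ℤ) % 2 = 0 := by omega
    rw [hr]
    omega
  · have hr : (n : ℤ) % 2 = 1 := by omega
    rw [hr]
    omega
end

section
/- Let n be a high extremal point of J, let m be the next high extremal point after n (i.e., m is a high extremal point, m > n, and there is no high extremal point strictly between n and m), and set f := n − J(n), r := n mod 2, and s := ((3·n + 2 − r)/2) mod 2 (the quantity (3·n + 2 − r)/2 is an integer). Then, as integers, m mod 2 = s − (1 − r)·(1 − f)·(2·s − 1). -/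
/-- Between a high extremal point `n` and the next one, `J` grows linearly with slope `3`. -/
theorem J_add_of_J_add_eq {n d : ℕ} (hn : 1 ≤ n) (hd : d ≤ 1) (hJ : J n + d = n) (k : ℕ)
    (hk : 2 * (k + 1) ≤ n + d + 1) : J (n + (k + 1)) + d = 3 * k + 2 := by
  induction k with
  | zero =>
    have hmod : (J n + 2) % (n + 1) = 1 - d := by
      rw [show J n + 2 = (1 - d) + (n + 1) by omega, Nat.add_mod_right,
        Nat.mod_eq_of_lt (by omega)]
    have h := J_succ hn
    rw [hmod] at h
    simp only [zero_add]
    omega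
  | succ k ih =>
    have hprev := ih (by omega)
    have h := J_succ (n := n + (k + 1)) (by omega)
    rw [Nat.mod_eq_of_lt (by omega), add_assoc] at h
    omega

/-- The distance from a high extremal point to the next one. -/
theorem next_high_extremal {n m d : ℕ} (hn : 1 ≤ n) (hd : d ≤ 1) (hJ : J n + d = n)
    (hm : IsHighExtremal m) (hlt : n < m)
    (hnext : ∀ k, n < k → k < m → ¬ IsHighExtremal k) : m = n + (n + d + 1) / 2 := by
  obtain ⟨K, hK⟩ : ∃ K, (n + d + 1) / 2 = K + 1 :=
    ⟨(n + d + 1) / 2 - 1, by omega⟩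
  have hJK := J_add_of_J_add_eq hn hd hJ K (by omega)
  have hle : m ≤ n + (K + 1) := by
    by_contra! hgt
    exact hnext (n + (K + 1)) (by omega) hgt ⟨by omega, by omega⟩
  obtain ⟨k, rfl⟩ : ∃ k, m = n + (k + 1) := ⟨m - n - 1, by omega⟩
  have hJk := J_add_of_J_add_eq hn hd hJ k (by omega)
  have hext := hm.2
  omega

theorem stmt_9 (n m : ℕ) (hn : IsHighExtremal n)
    (hm : IsHighExtremal m) (hlt : n < m)
    (hnext : ∀ k, n < k → k < m → ¬ IsHighExtremal k)
    (f r s : ℤ) (hf : f = (n : ℤ) - (J n : ℤ)) (hr : r = (n : ℤ) % 2)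
    (hs : s = ((3 * (n : ℤ) + 2 - r) / 2) % 2) :
    (m : ℤ) % 2 = s - (1 - r) * (1 - f) * (2 * s - 1) := by
  obtain ⟨hpos, hJ⟩ := hn
  obtain ⟨d, hd, hJd⟩ : ∃ d, d ≤ 1 ∧ J n + d = n := ⟨n - J n, by omega, by omega⟩
  have hmeq := next_high_extremal hpos hd hJd hm hlt hnext
  have hfd : f = d := by omega
  have hd' : d = 0 ∨ d = 1 := by omega
  have hr' : r = 0 ∨ r = 1 := by omega
  rcases hd' with rfl | rfl <;> rcases hr' with rfl | rfl <;> subst hfd <;> norm_num <;> omega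
end

section
/- Let p be a fixed point of J and let q be the next fixed point after p (i.e., q is a fixed point, q > p, and there is no fixed point strictly between p and q). Then the number of high extremal points k with p < k < q (all of which are pure high extremal points) equals the 2-adic valuation of 3·p + 2, i.e., equals max{m ∈ ℕ : 2^m divides 3·p + 2}. -/
/-- As long as no reduction takes place, `J` grows with slope `3`. -/
theorem J_add_of_le {m a : ℕ} (ha : J m = a) (j : ℕ) (h : a + 3 * j ≤ m + j) :
    J (m + j) = a + 3 * j := by
  induction j with
  | zero => simpa using ha
  | succ j ih =>
    rw [← add_assoc, J_succ (by omega), ih (by omega), Nat.mod_eq_of_lt (by omega)]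
    omega

/-- The value of `J` right after a high extremal point. -/
theorem J_succ_of_add_eq {n e : ℕ} (hn : 1 ≤ n) (he : e ≤ 1) (h : J n + e = n) :
    J (n + 1) = 2 - e := by
  rw [J_succ hn]
  interval_cases e
  · rw [show J n + 2 = 1 + (n + 1) by omega, Nat.add_mod_right, Nat.mod_eq_of_lt (by omega)]
  · rw [show J n + 2 = n + 1 by omega, Nat.mod_self]

/-- The high extremal point following a given one. -/
theorem next_highExtremal {n e n' e' : ℕ} (hn : 1 ≤ n) (he : e ≤ 1) (he' : e' ≤ 1)
    (h : J n + e = n) (hn' : 2 * n' + e' = 3 * n + 1 + e) :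
    J n' + e' = n' ∧ n < n' ∧ ∀ k, n < k → k < n' → ¬ IsHighExtremal k := by
  have h1 := J_succ_of_add_eq hn he h
  have hlt : n < n' := by omega
  refine ⟨?_, hlt, fun k hk hk' ⟨_, hJ⟩ => ?_⟩
  · obtain ⟨j, rfl⟩ := Nat.exists_eq_add_of_le (Nat.succ_le_of_lt hlt)
    rw [Nat.succ_eq_add_one] at *
    have := J_add_of_le h1 j (by omega)
    omega
  · obtain ⟨j, rfl⟩ := Nat.exists_eq_add_of_le (Nat.succ_le_of_lt hk)
    rw [Nat.succ_eq_add_one] at *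
    have := J_add_of_le h1 j (by omega)
    omega

/-- If the next high extremal point `n'` after `n` is fixed, there is none before the next fixed
point. -/
theorem ncard_highExtremal_of_fixed {n n' q : ℕ} (hfix : J n' = n') (hn : n < n')
    (hgap : ∀ k, n < k → k < n' → ¬ IsHighExtremal k)
    (hnext : ∀ k, n < k → k < q → J k ≠ k) :
    {k : ℕ | n < k ∧ k < q ∧ IsHighExtremal k}.ncard = 0 := by
  have hle : q ≤ n' := not_lt.1 fun hlt => hnext n' hn hlt hfix
  convert Set.ncard_empty ℕ
  ext k
  simp only [Set.mem_ofPred_eq, Set.mem_empty_iff_false, iff_false]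
  exact fun ⟨h1, h2, h3⟩ => hgap k h1 (by omega) h3

/-- If the next high extremal point `n'` after `n` is pure, it contributes one to the count. -/
theorem ncard_highExtremal_of_pure {n n' q : ℕ} (hpure : J n' + 1 = n') (hn : n < n')
    (hgap : ∀ k, n < k → k < n' → ¬ IsHighExtremal k) (hq : J q = q) (hlt : n < q) :
    n' < q ∧ {k : ℕ | n < k ∧ k < q ∧ IsHighExtremal k}.ncard =
      {k : ℕ | n' < k ∧ k < q ∧ IsHighExtremal k}.ncard + 1 := by
  have hn'q : n' < q := by
    by_contra hge
    have hne : q ≠ n' := by rintro rfl; omega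
    exact hgap q hlt (by omega) ⟨by omega, Or.inr hq⟩
  refine ⟨hn'q, ?_⟩
  have hfin : {k : ℕ | n' < k ∧ k < q ∧ IsHighExtremal k}.Finite :=
    (Set.finite_Iio q).subset fun k hk => hk.2.1
  rw [← Set.ncard_insert_of_notMem (a := n') (by simp) hfin]
  congr 1
  ext k
  simp only [Set.mem_ofPred_eq, Set.mem_insert_iff]
  constructor
  · rintro ⟨h1, h2, h3⟩
    have : ¬ k < n' := fun h => hgap k h1 h h3
    by_cases hk : k = n'
    · exact Or.inl hk
    · exact Or.inr ⟨by omega, h2, h3⟩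
  · rintro (rfl | ⟨h1, h2, h3⟩)
    · exact ⟨hn, hn'q, by omega, Or.inl (by omega)⟩
    · exact ⟨by omega, h2, h3⟩

theorem padicValNat_two_three_mul {a : ℕ} (ha : a ≠ 0) :
    padicValNat 2 (3 * a) = padicValNat 2 a := by
  rw [padicValNat.mul (by norm_num) ha, padicValNat.eq_zero_of_not_dvd (by norm_num), zero_add]

theorem padicValNat_two_two_mul {a : ℕ} (ha : a ≠ 0) :
    padicValNat 2 (2 * a) = padicValNat 2 a + 1 := by
  rw [padicValNat.mul (by norm_num) ha, padicValNat_self, add_comm]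

/-- The number of high extremal points strictly between a pure high extremal point and the next
fixed point. -/
theorem ncard_highExtremal_after_pure (q : ℕ) (hq : J q = q) (n : ℕ) (hn : 1 ≤ n)
    (h : J n + 1 = n) (hlt : n < q) (hnext : ∀ k, n < k → k < q → J k ≠ k) :
    {k : ℕ | n < k ∧ k < q ∧ IsHighExtremal k}.ncard = padicValNat 2 (n + 1) := by
  rcases Nat.even_or_odd' n with ⟨c, hc | hc⟩
  · obtain ⟨h1, h2, h3⟩ := next_highExtremal (n' := 3 * c + 1) (e' := 0) hn le_rfl zero_le_one h
      (by omega)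
    rw [ncard_highExtremal_of_fixed h1 h2 h3 hnext, padicValNat.eq_zero_of_not_dvd (by omega)]
  · obtain ⟨h1, h2, h3⟩ := next_highExtremal (n' := 3 * c + 2) (e' := 1) hn le_rfl le_rfl h
      (by omega)
    obtain ⟨h4, h5⟩ := ncard_highExtremal_of_pure h1 h2 h3 hq hlt
    rw [h5, ncard_highExtremal_after_pure q hq (3 * c + 2) (by omega) h1 h4
        fun k hk => hnext k (h2.trans hk),
      show 3 * c + 2 + 1 = 3 * (c + 1) by ring, show n + 1 = 2 * (c + 1) by omega,
      padicValNat_two_three_mul (by omega), padicValNat_two_two_mul (by omega)]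
termination_by q - n

theorem stmt_10 (p q : ℕ) (hp1 : 1 ≤ p) (hp : J p = p)
    (hq : J q = q) (hlt : p < q)
    (hnext : ∀ k, p < k → k < q → J k ≠ k) :
    {k : ℕ | p < k ∧ k < q ∧ IsHighExtremal k}.ncard = padicValNat 2 (3 * p + 2) := by
  rcases Nat.even_or_odd' p with ⟨c, hc | hc⟩
  · obtain ⟨h1, h2, h3⟩ := next_highExtremal (n' := 3 * c) (e' := 1) hp1 zero_le_one le_rfl hp
      (by omega)
    obtain ⟨h4, h5⟩ := ncard_highExtremal_of_pure h1 h2 h3 hq hlt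
    rw [h5, ncard_highExtremal_after_pure q hq (3 * c) (by omega) h1 h4
        fun k hk => hnext k (h2.trans hk),
      show 3 * p + 2 = 2 * (3 * c + 1) by omega, padicValNat_two_two_mul (by omega)]
  · obtain ⟨h1, h2, h3⟩ := next_highExtremal (n' := 3 * c + 2) (e' := 0) hp1 zero_le_one
      zero_le_one hp (by omega)
    rw [ncard_highExtremal_of_fixed h1 h2 h3 hnext, padicValNat.eq_zero_of_not_dvd (by omega)]
end

section
/- Let p be a fixed point of J and let m̄ ≥ 1 be the 2-adic valuation of 3·p + 2. For 1 ≤ j ≤ m̄ set e_j := 3^{j−1}·(3·p + 2)/2^{j} − 1 and e_0 := p. Then for every j with 1 ≤ j ≤ m̄ and every n with e_{j−1} < n ≤ e_j, one has J(n) = 3·n + 1 − 3^{j−1}·(3·p + 2)/2^{j−1}. -/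
/-- As long as no reduction occurs, `J` grows with slope `3`. -/
theorem J_add_eq_of_lt {s B : ℕ} (hs : J (s + 1) + 2 * B = 3 * (s + 1) + 1) {n : ℕ}
    (hsn : s + 1 ≤ n) : n < B → J n + 2 * B = 3 * n + 1 := by
  induction n, hsn using Nat.le_induction with
  | base => exact fun _ => hs
  | succ n hn ih =>
    intro h
    have hJ := ih (by omega)
    rw [J_succ (by omega), Nat.mod_eq_of_lt (by omega)]
    omega

/-- The value of `J` just after a pure high extremal point is `1`. -/
theorem J_succ_eq_one {n : ℕ} (h : J n + 1 = n) : J (n + 1) = 1 := by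
  rw [J_succ (by omega), show J n + 2 = n + 1 by omega, Nat.mod_self]

/-- The value of `J` just after a fixed point is `2`. -/
theorem J_succ_eq_two {n : ℕ} (hn : 1 ≤ n) (h : J n = n) : J (n + 1) = 2 := by
  rw [J_succ hn, h, show n + 2 = 1 + (n + 1) by omega, Nat.add_mod_right,
    Nat.mod_eq_of_lt (by omega)]

theorem three_pow_mul_div_two_pow {N k c : ℕ} (i : ℕ) (h : N = 2 ^ k * c) :
    3 ^ i * N / 2 ^ k = 3 ^ i * c := by
  rw [h, mul_left_comm, Nat.mul_div_cancel_left _ (by positivity)]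

theorem stmt_15 (p : ℕ) (hp1 : 1 ≤ p) (hp : J p = p)
    (mbar : ℕ) (hmbar : mbar = padicValNat 2 (3 * p + 2)) (hm1 : 1 ≤ mbar)
    (e : ℕ → ℕ) (he0 : e 0 = p)
    (hej : ∀ j, 1 ≤ j → j ≤ mbar → e j = 3 ^ (j - 1) * (3 * p + 2) / 2 ^ j - 1) :
    ∀ j, 1 ≤ j → j ≤ mbar → ∀ n, e (j - 1) < n → n ≤ e j →
      (J n : ℤ) = 3 * (n : ℤ) + 1 - ((3 ^ (j - 1) * (3 * p + 2) / 2 ^ (j - 1) : ℕ) : ℤ) := by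
  have hdvd : ∀ j, j ≤ mbar → 2 ^ j ∣ 3 * p + 2 := fun j hj =>
    (pow_dvd_pow 2 hj).trans (hmbar ▸ pow_padicValNat_dvd)
  have key : ∀ k c, k + 1 ≤ mbar → 3 * p + 2 = 2 ^ (k + 1) * c →
      J (e k + 1) + 2 * (3 ^ k * c) = 3 * (e k + 1) + 1 ∧ e k + 1 < 3 ^ k * c := by
    intro k
    induction k with
    | zero =>
      intro c _ hc
      rw [he0, J_succ_eq_two hp1 hp]
      omega
    | succ i ih =>
      intro c hi hc
      obtain ⟨hJ, hlt⟩ := ih (2 * c) (by omega) (by rw [hc]; ring)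
      have he : e (i + 1) = 3 ^ i * (2 * c) - 1 := by
        rw [hej (i + 1) (by omega) (by omega), Nat.add_sub_cancel,
          three_pow_mul_div_two_pow i (show 3 * p + 2 = 2 ^ (i + 1) * (2 * c) by rw [hc]; ring)]
      have hend := J_add_eq_of_lt hJ (n := e (i + 1)) (by omega) (by omega)
      have hpow : 3 ^ (i + 1) * c = 3 * (3 ^ i * c) := by ring
      have htwo : 3 ^ i * (2 * c) = 2 * (3 ^ i * c) := by ring
      have hone := J_succ_eq_one (n := e (i + 1)) (by omega)
      omega
  intro j hj1 hjm n hn hne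
  obtain ⟨k, rfl⟩ := Nat.exists_eq_add_of_le' hj1
  obtain ⟨c, hc⟩ := hdvd _ hjm
  rw [hej _ hj1 hjm, Nat.add_sub_cancel, three_pow_mul_div_two_pow k hc] at hne
  rw [Nat.add_sub_cancel] at hn ⊢
  rw [three_pow_mul_div_two_pow k (show 3 * p + 2 = 2 ^ k * (2 * c) by rw [hc]; ring)]
  obtain ⟨hJ, hlt⟩ := key k c hjm hc
  have hJn := J_add_eq_of_lt hJ (n := n) hn (by omega)
  have htwo : 3 ^ k * (2 * c) = 2 * (3 ^ k * c) := by ring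
  omega
end

section
/- Let p be a fixed point of J, let q be the next fixed point after p (i.e., q is a fixed point, q > p, and there is no fixed point strictly between p and q), and let m̄ be the 2-adic valuation of 3·p + 2. Then 2^{m̄}·(2·q + 1) = 3^{m̄}·(3·p + 2); in particular, m̄ = ⌈log_{3/2}((2q+1)/(3p+2))⌉, i.e., m̄ is the least natural number k such that 2^k·(2·q + 1) ≤ 3^k·(3·p + 2). -/
/-- As long as it does not wrap around, `J` grows in steps of `3`. -/
theorem J_add {s : ℕ} (i : ℕ) (hi : J s + 2 * i ≤ s) :
    J (s + i) = J s + 3 * i := by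
  induction i with
  | zero => rfl
  | succ i ih =>
    rw [← add_assoc, J_succ (by omega), ih (by omega), Nat.mod_eq_of_lt (by omega)]
    ring

theorem J_succ_of_fixed {p : ℕ} (hp1 : 1 ≤ p) (hp : J p = p) : J (p + 1) = 2 := by
  rw [J_succ hp1, hp, show p + 2 = 1 + (p + 1) by ring, Nat.add_mod_right,
    Nat.mod_eq_of_lt (by omega)]

theorem J_succ_of_pure {e : ℕ} (he1 : 1 ≤ e) (he : J e = e - 1) : J (e + 1) = 1 := by
  rw [J_succ he1, he, show e - 1 + 2 = e + 1 by omega, Nat.mod_self]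

/-- The next fixed point `q` after a pure high extremal point `e` with `e + 1 = 2 ^ v * o`,
`o` odd. -/
theorem next_fixed_of_pure (v : ℕ) {e q o : ℕ} (he1 : 1 ≤ e) (he : J e = e - 1)
    (hq : J q = q) (hlt : e < q) (hnext : ∀ k, e < k → k < q → J k ≠ k)
    (ho : Odd o) (heo : e + 1 = 2 ^ v * o) : 2 * q + 1 = 3 ^ (v + 1) * o := by
  have h1 := J_succ_of_pure he1 he
  have hrun (i : ℕ) (hi : 1 + 2 * i ≤ e + 1) : J (e + 1 + i) = 1 + 3 * i := by
    rw [J_add i (by omega), h1]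
  obtain ⟨d, rfl⟩ := Nat.exists_eq_add_of_le (Nat.succ_le_of_lt hlt)
  rw [Nat.succ_eq_add_one] at *
  induction v generalizing e o d with
  | zero =>
    obtain ⟨t, rfl⟩ := ho
    have hd : d ≤ t := by
      by_contra! hd
      refine hnext (e + 1 + t) (by omega) (by omega) ?_
      rw [hrun t (by omega)]
      omega
    have := hrun d (by omega)
    omega
  | succ v ih =>
    have hpow : e + 1 = 2 * (2 ^ v * o) := by rw [heo]; ring
    generalize hw : 2 ^ v * o = w at hpow
    have hd : w - 1 < d := by
      by_contra! hd
      have := hrun d (by omega)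
      omega
    have hJ : J (3 * w - 1) = 3 * w - 1 - 1 := by
      have := hrun (w - 1) (by omega)
      rw [show e + 1 + (w - 1) = 3 * w - 1 by omega] at this
      omega
    have h1' := J_succ_of_pure (by omega) hJ
    have hq' : e + 1 + d = 3 * w - 1 + 1 + (d - w) := by omega
    have := ih (e := 3 * w - 1) (o := 3 * o) (by omega) hJ (Odd.mul (by decide) ho)
      (by rw [Nat.sub_add_cancel (by omega), ← hw]; ring) h1'
      (fun i hi => by rw [J_add i (by omega), h1'])
      (d - w) (hq' ▸ hq) (by omega) (fun k hk hk' => hnext k (by omega) (by omega))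
    rw [hq', this]
    ring

/-- The next fixed point `q` after a fixed point `p` with `3 * p + 2 = 2 ^ m * o`, `o` odd. -/
theorem next_fixed_of_fixed {p q m o : ℕ} (hp1 : 1 ≤ p) (hp : J p = p)
    (hq : J q = q) (hlt : p < q) (hnext : ∀ k, p < k → k < q → J k ≠ k)
    (ho : Odd o) (hpo : 3 * p + 2 = 2 ^ m * o) : 2 * q + 1 = 3 ^ m * o := by
  have h1 := J_succ_of_fixed hp1 hp
  have hrun (i : ℕ) (hi : 2 + 2 * i ≤ p + 1) : J (p + 1 + i) = 2 + 3 * i := by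
    rw [J_add i (by omega), h1]
  obtain ⟨d, rfl⟩ := Nat.exists_eq_add_of_le (Nat.succ_le_of_lt hlt)
  rw [Nat.succ_eq_add_one] at *
  cases m with
  | zero =>
    obtain ⟨t, rfl⟩ := ho
    have hd : d ≤ (p - 1) / 2 := by
      by_contra! hd
      refine hnext (p + 1 + (p - 1) / 2) (by omega) (by omega) ?_
      rw [hrun _ (by omega)]
      omega
    have := hrun d (by omega)
    omega
  | succ v =>
    have hpow : 3 * p + 2 = 2 * (2 ^ v * o) := by rw [hpo]; ring
    generalize hw : 2 ^ v * o = w at hpow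
    have hd : p / 2 - 1 < d := by
      by_contra! hd
      have := hrun d (by omega)
      omega
    have hJ : J (w - 1) = w - 1 - 1 := by
      have := hrun (p / 2 - 1) (by omega)
      rw [show p + 1 + (p / 2 - 1) = w - 1 by omega] at this
      omega
    exact next_fixed_of_pure v (by omega) hJ hq (by omega)
      (fun k hk hk' => hnext k (by omega) hk') ho (by omega)

theorem isLeast_of_two_pow_mul_eq {a b m : ℕ} (hb : 0 < b) (h : 2 ^ m * a = 3 ^ m * b) :
    IsLeast {k : ℕ | 2 ^ k * a ≤ 3 ^ k * b} m := by
  refine ⟨h.le, fun k hk => ?_⟩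
  by_contra! hkm
  obtain ⟨d, rfl⟩ := Nat.exists_eq_add_of_lt hkm
  have hpow : 2 ^ (d + 1) < 3 ^ (d + 1) := Nat.pow_lt_pow_left (by norm_num) (by omega)
  have hpos : 0 < 3 ^ k * b := by positivity
  have hle : 2 ^ (d + 1) * (2 ^ k * a) ≤ 2 ^ (d + 1) * (3 ^ k * b) := Nat.mul_le_mul_left _ hk
  have heq : 2 ^ (d + 1) * (2 ^ k * a) = 3 ^ (d + 1) * (3 ^ k * b) := by
    rw [← mul_assoc, ← mul_assoc, ← pow_add, ← pow_add, add_comm (d + 1) k, ← add_assoc, h]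
  exact absurd (Nat.mul_lt_mul_of_pos_right hpow hpos) (by omega)

theorem stmt_17 (p q : ℕ) (hp1 : 1 ≤ p) (hp : J p = p)
    (hq : J q = q) (hlt : p < q)
    (hnext : ∀ k, p < k → k < q → J k ≠ k)
    (mbar : ℕ) (hmbar : mbar = padicValNat 2 (3 * p + 2)) :
    2 ^ mbar * (2 * q + 1) = 3 ^ mbar * (3 * p + 2) ∧
      IsLeast {k : ℕ | 2 ^ k * (2 * q + 1) ≤ 3 ^ k * (3 * p + 2)} mbar := by
  have hne : 3 * p + 2 ≠ 0 := by omega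
  have hdvd : 2 ^ mbar ∣ 3 * p + 2 := hmbar ▸ pow_padicValNat_dvd
  have hndvd : ¬ 2 ^ (mbar + 1) ∣ 3 * p + 2 := hmbar ▸ pow_succ_padicValNat_not_dvd hne
  obtain ⟨o, hpo⟩ := hdvd
  have ho : Odd o := by
    rw [← Nat.not_even_iff_odd, even_iff_two_dvd]
    rintro ⟨c, rfl⟩
    exact hndvd ⟨c, by rw [hpo]; ring⟩
  have heq : 2 ^ mbar * (2 * q + 1) = 3 ^ mbar * (3 * p + 2) := by
    rw [next_fixed_of_fixed hp1 hp hq hlt hnext ho hpo, hpo]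
    ring
  exact ⟨heq, isLeast_of_two_pow_mul_eq (by omega) heq⟩
end

section
/- Let p be a fixed point of J and let m̄ ≥ 1 be the 2-adic valuation of 3·p + 2. For 1 ≤ j ≤ m̄ set e_j := 3^{j−1}·(3·p + 2)/2^{j} − 1 and e_0 := p. Then for every j with 1 ≤ j ≤ m̄ and every n with e_{j−1} < n ≤ e_j, the least natural number k such that 2^k·(2·n + 1) ≤ 3^k·(3·p + 2) equals j − 1 (equivalently, ⌈log_{3/2}((2n+1)/(3p+2))⌉ = j − 1). -/
/-- If `2 ^ k * a ≤ 3 ^ k * b` holds for some `k`, it holds for every larger exponent. -/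
theorem two_pow_mul_le_three_pow_mul_of_le {a b k l : ℕ} (hkl : k ≤ l)
    (h : 2 ^ k * a ≤ 3 ^ k * b) : 2 ^ l * a ≤ 3 ^ l * b := by
  obtain ⟨d, rfl⟩ := Nat.exists_eq_add_of_le hkl
  calc 2 ^ (k + d) * a = 2 ^ d * (2 ^ k * a) := by ring
    _ ≤ 3 ^ d * (3 ^ k * b) := Nat.mul_le_mul (Nat.pow_le_pow_left (by norm_num) d) h
    _ = 3 ^ (k + d) * b := by ring

theorem stmt_19 (p : ℕ) (hp1 : 1 ≤ p) (hp : J p = p)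
    (mbar : ℕ) (hmbar : mbar = padicValNat 2 (3 * p + 2)) (hm1 : 1 ≤ mbar)
    (e : ℕ → ℕ) (he0 : e 0 = p)
    (hej : ∀ j, 1 ≤ j → j ≤ mbar → e j = 3 ^ (j - 1) * (3 * p + 2) / 2 ^ j - 1) :
    ∀ j, 1 ≤ j → j ≤ mbar → ∀ n, e (j - 1) < n → n ≤ e j →
      IsLeast {k : ℕ | 2 ^ k * (2 * n + 1) ≤ 3 ^ k * (3 * p + 2)} (j - 1) := by
  have hdvd : ∀ i, i ≤ mbar → 2 ^ i ∣ 3 * p + 2 := fun i hi =>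
    (pow_dvd_pow 2 (hmbar ▸ hi)).trans pow_padicValNat_dvd
  have he : ∀ i, i + 1 ≤ mbar → 2 ^ (i + 1) * (e (i + 1) + 1) = 3 ^ i * (3 * p + 2) := by
    intro i hi
    obtain ⟨c, hc⟩ := hdvd (i + 1) hi
    have hquot : 3 ^ i * (3 * p + 2) / 2 ^ (i + 1) = 3 ^ i * c := by
      rw [hc, mul_left_comm, Nat.mul_div_cancel_left _ (by positivity)]
    have hcpos : 0 < c := Nat.pos_of_ne_zero (by rintro rfl; simp at hc)
    have hpos : 1 ≤ 3 ^ i * c := Nat.mul_pos (by positivity) hcpos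
    rw [hej (i + 1) (by omega) hi, Nat.add_sub_cancel, hquot, Nat.sub_add_cancel hpos, hc]
    ring
  intro j hj1 hjm n hlo hhi
  obtain ⟨k, rfl⟩ := Nat.exists_eq_add_of_le' hj1
  rw [Nat.add_sub_cancel] at hlo ⊢
  constructor
  · calc 2 ^ k * (2 * n + 1) ≤ 2 ^ k * (2 * (e (k + 1) + 1)) :=
          Nat.mul_le_mul_left _ (by omega)
      _ = 2 ^ (k + 1) * (e (k + 1) + 1) := by ring
      _ = 3 ^ k * (3 * p + 2) := he k hjm
  · intro l hl
    by_contra! hlk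
    obtain ⟨i, rfl⟩ := Nat.exists_eq_add_of_lt (Nat.zero_lt_of_lt hlk)
    rw [Nat.zero_add] at *
    have hle := two_pow_mul_le_three_pow_mul_of_le (Nat.le_of_lt_succ hlk) hl
    have hlt : 3 ^ i * (3 * p + 2) < 2 ^ i * (2 * n + 1) := by
      calc 3 ^ i * (3 * p + 2) = 2 ^ i * (2 * (e (i + 1) + 1)) := by
            rw [← he i (by omega)]; ring
        _ < 2 ^ i * (2 * n + 1) := Nat.mul_lt_mul_of_pos_left (by omega) (by positivity)
    omega
end
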